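/- arXiv:2510.19735 — 2 statements merged into one kernel-verified Lean document; each statement's English description precedes it below -/
import Mathlib

section
/- Let (G, Γ*) be a self-similar groupoid and suppose Γ is finite. Then the contracted inverse semigroup algebra KS_{(G,Γ*)} is unital, with identity 1 = Σ_{v∈Γ⁰} v. Furthermore, the Cuntz–Krieger ideal of KS_{(G,Γ*)} is principally generated by the single element 1 − Σ_{e∈Γ¹} ee*. -/
set_option autoImplicit false

/-! ## Directed graphs and path trees -/

/-- A row-finite directed graph. -/
structure DirGraph where
  V : Type
  E : Type
  src : E → V
  rng : E → V
  rowFinite : ∀ v : V, {e : E | src e = v}.Finite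

/-- `Γ.IsPathFrom v l` : the list of edges `l` is a (finite) path with source `v`. -/
def DirGraph.IsPathFrom (Γ : DirGraph) : Γ.V → List Γ.E → Prop
  | _, [] => True
  | v, e :: l => Γ.src e = v ∧ DirGraph.IsPathFrom Γ (Γ.rng e) l

/-- The range (terminal vertex) of a path with source `v` and edge list `l`. -/
def DirGraph.rng0 (Γ : DirGraph) : Γ.V → List Γ.E → Γ.V
  | v, [] => v
  | _, e :: l => DirGraph.rng0 Γ (Γ.rng e) l

/-- An isomorphism of rooted path trees `(dom)Γ* → (cod)Γ*`: a bijection between the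
paths with source `dom` and the paths with source `cod` which fixes the root and maps
children to children (equivalently, a directed-graph isomorphism of the rooted trees). -/
structure Arrow (Γ : DirGraph) where
  dom : Γ.V
  cod : Γ.V
  act : List Γ.E → List Γ.E
  inv : List Γ.E → List Γ.E
  act_maps : ∀ l, Γ.IsPathFrom dom l → Γ.IsPathFrom cod (act l)
  inv_maps : ∀ l, Γ.IsPathFrom cod l → Γ.IsPathFrom dom (inv l)
  left_inv : ∀ l, Γ.IsPathFrom dom l → inv (act l) = l
  right_inv : ∀ l, Γ.IsPathFrom cod l → act (inv l) = l
  act_nil : act [] = []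
  act_snoc : ∀ l e, Γ.IsPathFrom dom (l ++ [e]) → ∃ e', act (l ++ [e]) = act l ++ [e']

/-- The identity tree isomorphism at a vertex `v`. -/
def Arrow.idArrow (Γ : DirGraph) (v : Γ.V) : Arrow Γ where
  dom := v
  cod := v
  act := fun l => l
  inv := fun l => l
  act_maps := fun _ h => h
  inv_maps := fun _ h => h
  left_inv := fun _ _ => rfl
  right_inv := fun _ _ => rfl
  act_nil := rfl
  act_snoc := fun _ e _ => ⟨e, rfl⟩

namespace Arrow

variable {Γ : DirGraph}

/-- Two arrows represent the same tree isomorphism (they agree on all genuine paths). -/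
def Same (g h : Arrow Γ) : Prop :=
  g.dom = h.dom ∧ g.cod = h.cod ∧ ∀ l, Γ.IsPathFrom g.dom l → g.act l = h.act l

/-- `k` represents the identity isomorphism of `v Γ*`. -/
def IsIdArrow (v : Γ.V) (k : Arrow Γ) : Prop :=
  k.dom = v ∧ k.cod = v ∧ ∀ l, Γ.IsPathFrom v l → k.act l = l

/-- `k` represents the composition `g ∘ h` (first `h`, then `g`). -/
def IsComposition (g h k : Arrow Γ) : Prop :=
  h.cod = g.dom ∧ k.dom = h.dom ∧ k.cod = g.cod ∧
  ∀ l, Γ.IsPathFrom h.dom l → k.act l = g.act (h.act l)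

/-- `k` represents the inverse isomorphism of `g`. -/
def IsInverseArrow (g k : Arrow Γ) : Prop :=
  k.dom = g.cod ∧ k.cod = g.dom ∧ ∀ l, Γ.IsPathFrom g.dom l → k.act (g.act l) = l

/-- `h` represents the restriction `g|_p` of `g` to the path `p`, characterized by
`g(pq) = g(p)·h(q)` for all paths `q` with source `r(p)`. -/
def IsRestrictOf (g : Arrow Γ) (p : List Γ.E) (h : Arrow Γ) : Prop :=
  h.dom = Γ.rng0 g.dom p ∧ h.cod = Γ.rng0 g.cod (g.act p) ∧
  ∀ q, Γ.IsPathFrom (Γ.rng0 g.dom p) q → g.act (p ++ q) = g.act p ++ h.act q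

end Arrow

/-! ## Self-similar groupoids -/

/-- A self-similar groupoid `(G, Γ*)` : a set of tree isomorphisms (closed under
representing-the-same-isomorphism) which contains all the identities, is closed under
composition and inverses (a groupoid with object set `Γ⁰` acting faithfully on `Γ*`),
and is closed under restriction: for every `g ∈ G` and edge `e` in the domain of `g`
there is `g|_e ∈ G` with `g(ep) = g(e)·g|_e(p)`. -/
structure SSG (Γ : DirGraph) where
  carrier : Set (Arrow Γ)
  satur : ∀ g g', g ∈ carrier → g.Same g' → g' ∈ carrier
  id_mem : ∀ v, Arrow.idArrow Γ v ∈ carrier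
  comp_mem : ∀ g h k, g ∈ carrier → h ∈ carrier → Arrow.IsComposition g h k → k ∈ carrier
  inv_mem : ∀ g k, g ∈ carrier → Arrow.IsInverseArrow g k → k ∈ carrier
  restrict_mem : ∀ g ∈ carrier, ∀ e : Γ.E, Γ.src e = g.dom →
    ∃ h ∈ carrier, g.IsRestrictOf [e] h

/-- The condition: for each pair of distinct vertices `v, w` there exist paths
`p ∈ wΓ*` and `q ∈ vΓ*` such that `G` intersects `Iso(r(p), v)` and `Iso(r(q), w)`. -/
def OrbitCond (Γ : DirGraph) (Gs : SSG Γ) : Prop :=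
  ∀ v w : Γ.V, v ≠ w →
    (∃ p, Γ.IsPathFrom w p ∧ ∃ g ∈ Gs.carrier, g.dom = Γ.rng0 w p ∧ g.cod = v) ∧
    (∃ q, Γ.IsPathFrom v q ∧ ∃ g ∈ Gs.carrier, g.dom = Γ.rng0 v q ∧ g.cod = w)

/-- Type (CF): every vertex emits more than one edge, and the orbit condition holds. -/
def TypeCF (Γ : DirGraph) (Gs : SSG Γ) : Prop :=
  (∀ v : Γ.V, ∃ e f : Γ.E, e ≠ f ∧ Γ.src e = v ∧ Γ.src f = v) ∧ OrbitCond Γ Gs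

/-! ## Contracting self-similar groupoids, nuclei, recurrent subgroups -/

/-- Every element of `G` eventually restricts into `A`. -/
def ContractsInto {Γ : DirGraph} (Gs : SSG Γ) (A : Set (Arrow Γ)) : Prop :=
  ∀ g ∈ Gs.carrier, ∃ n : ℕ, ∀ l, Γ.IsPathFrom g.dom l → l.length = n →
    ∃ h ∈ A, g.IsRestrictOf l h

/-- A set of arrows covering only finitely many tree isomorphisms. -/
def FinUpToSame {Γ : DirGraph} (A : Set (Arrow Γ)) : Prop :=
  ∃ B : Finset (Arrow Γ), ∀ g ∈ A, ∃ h ∈ B, g.Same h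

/-- `(G, Γ*)` is contracting. -/
def IsContracting {Γ : DirGraph} (Gs : SSG Γ) : Prop :=
  ∃ A : Set (Arrow Γ), A ⊆ Gs.carrier ∧ FinUpToSame A ∧ ContractsInto Gs A

/-- `N` is the nucleus of `(G, Γ*)` : a minimal finite subset of `G` into which every
element of `G` eventually restricts. -/
def IsNucleus {Γ : DirGraph} (Gs : SSG Γ) (N : Set (Arrow Γ)) : Prop :=
  N ⊆ Gs.carrier ∧ FinUpToSame N ∧ ContractsInto Gs N ∧
  ∀ A : Set (Arrow Γ), A ⊆ Gs.carrier → FinUpToSame A → ContractsInto Gs A →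
    ∀ g ∈ N, ∃ h ∈ A, g.Same h

/-- The recurrent set `H_p = {g ∈ G : g(p) = p, g|_p = g}` for a path `p ∈ vΓ*`. -/
def Hp {Γ : DirGraph} (Gs : SSG Γ) (v : Γ.V) (p : List Γ.E) : Set (Arrow Γ) :=
  {g | g ∈ Gs.carrier ∧ g.dom = v ∧ g.cod = v ∧ g.act p = p ∧ g.IsRestrictOf p g}

/-! ## The associated inverse semigroup `S_{(G,Γ*)}` -/

/-- The product in `S` of a path: `p = e₁ e₂ ⋯ eₙ · r(p)` (just `v` for the empty path). -/
def pathProd {Γ : DirGraph} {S : Type} (mul : S → S → S) (ιV : Γ.V → S) (ιE : Γ.E → S)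
    (v : Γ.V) (p : List Γ.E) : S :=
  p.foldr (fun e a => mul (ιE e) a) (ιV (Γ.rng0 v p))

/-- The inverse semigroup with zero `S_{(G,Γ*)}` associated to a self-similar groupoid,
presented through its characterizing properties: it is an inverse semigroup with zero,
generated by `Γ⁰ ∪ Γ¹ ∪ Γ⁻¹ ∪ G` subject to the defining relations, in which every
nonzero element has a unique canonical form `p g q*`. -/
structure AssocISG (Γ : DirGraph) (Gs : SSG Γ) where
  S : Type
  mul : S → S → S
  zero : S
  star : S → S
  mul_assoc : ∀ a b c, mul (mul a b) c = mul a (mul b c)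
  zero_mul : ∀ a, mul zero a = zero
  mul_zero : ∀ a, mul a zero = zero
  inv_ax : ∀ a, mul (mul a (star a)) a = a ∧ mul (mul (star a) a) (star a) = star a
  inv_unique : ∀ a b, mul (mul a b) a = a → mul (mul b a) b = b → b = star a
  ιV : Γ.V → S
  ιE : Γ.E → S
  ιG : Arrow Γ → S
  ιG_same : ∀ g h, g.Same h → ιG g = ιG h
  rel_src : ∀ e, mul (ιV (Γ.src e)) (ιE e) = ιE e
  rel_rng : ∀ e, mul (ιE e) (ιV (Γ.rng e)) = ιE e
  rel_vv : ∀ u v, u ≠ v → mul (ιV u) (ιV v) = zero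
  rel_v_idem : ∀ v, mul (ιV v) (ιV v) = ιV v
  rel_star_v : ∀ v, star (ιV v) = ιV v
  rel_ef : ∀ e f, e ≠ f → mul (star (ιE e)) (ιE f) = zero
  rel_ee : ∀ e, mul (star (ιE e)) (ιE e) = ιV (Γ.rng e)
  rel_comp : ∀ g h k, g ∈ Gs.carrier → h ∈ Gs.carrier → Arrow.IsComposition g h k →
    mul (ιG g) (ιG h) = ιG k
  rel_notcomp : ∀ g h, g ∈ Gs.carrier → h ∈ Gs.carrier → h.cod ≠ g.dom →
    mul (ιG g) (ιG h) = zero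
  rel_star : ∀ g k, g ∈ Gs.carrier → Arrow.IsInverseArrow g k → star (ιG g) = ιG k
  rel_id : ∀ v, ιG (Arrow.idArrow Γ v) = ιV v
  rel_ge : ∀ g ∈ Gs.carrier, ∀ (e e' : Γ.E) (h : Arrow Γ), Γ.src e = g.dom →
    g.act [e] = [e'] → g.IsRestrictOf [e] h → mul (ιG g) (ιE e) = mul (ιE e') (ιG h)
  canon_ex : ∀ s, s ≠ zero → ∃ (v w : Γ.V) (p q : List Γ.E) (g : Arrow Γ),
    Γ.IsPathFrom v p ∧ Γ.IsPathFrom w q ∧ g ∈ Gs.carrier ∧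
    g.dom = Γ.rng0 w q ∧ g.cod = Γ.rng0 v p ∧
    s = mul (mul (pathProd mul ιV ιE v p) (ιG g)) (star (pathProd mul ιV ιE w q))
  canon_nonzero : ∀ (v w : Γ.V) (p q : List Γ.E) (g : Arrow Γ),
    Γ.IsPathFrom v p → Γ.IsPathFrom w q → g ∈ Gs.carrier →
    g.dom = Γ.rng0 w q → g.cod = Γ.rng0 v p →
    mul (mul (pathProd mul ιV ιE v p) (ιG g)) (star (pathProd mul ιV ιE w q)) ≠ zero
  canon_inj : ∀ (v w v' w' : Γ.V) (p q p' q' : List Γ.E) (g g' : Arrow Γ),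
    Γ.IsPathFrom v p → Γ.IsPathFrom w q → g ∈ Gs.carrier →
    g.dom = Γ.rng0 w q → g.cod = Γ.rng0 v p →
    Γ.IsPathFrom v' p' → Γ.IsPathFrom w' q' → g' ∈ Gs.carrier →
    g'.dom = Γ.rng0 w' q' → g'.cod = Γ.rng0 v' p' →
    mul (mul (pathProd mul ιV ιE v p) (ιG g)) (star (pathProd mul ιV ιE w q)) =
      mul (mul (pathProd mul ιV ιE v' p') (ιG g')) (star (pathProd mul ιV ιE w' q')) →
    v = v' ∧ w = w' ∧ p = p' ∧ q = q' ∧ g.Same g'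

namespace AssocISG

variable {Γ : DirGraph} {Gs : SSG Γ}

/-- The element of `S` represented by a path. -/
def P (T : AssocISG Γ Gs) (v : Γ.V) (p : List Γ.E) : T.S :=
  pathProd T.mul T.ιV T.ιE v p

def IsIdem (T : AssocISG Γ Gs) (e : T.S) : Prop := T.mul e e = e

/-- The natural partial order on idempotents: `f ≤ e` iff `f = g e` for an idempotent `g`. -/
def idemLe (T : AssocISG Γ Gs) (f e : T.S) : Prop := ∃ g, T.IsIdem g ∧ f = T.mul g e

/-- A congruence on `S`. -/
def IsCongruence (T : AssocISG Γ Gs) (r : T.S → T.S → Prop) : Prop :=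
  Equivalence r ∧ ∀ a b c, r a b → r (T.mul c a) (T.mul c b) ∧ r (T.mul a c) (T.mul b c)

/-- `S` is congruence-free: its only congruences are equality and the universal relation. -/
def CongruenceFree (T : AssocISG Γ Gs) : Prop :=
  ∀ r, T.IsCongruence r → (∀ a b, r a b ↔ a = b) ∨ (∀ a b, r a b)

/-- `S` is fundamental. -/
def Fundamental (T : AssocISG Γ Gs) : Prop :=
  ∀ a b : T.S,
    (∀ e, T.IsIdem e → T.mul (T.mul a e) (T.star a) = T.mul (T.mul b e) (T.star b)) → a = b

/-- `S` is 0-simple: its only (two-sided semigroup) ideals are `{0}` and `S`. -/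
def ZeroSimple (T : AssocISG Γ Gs) : Prop :=
  ∀ J : Set T.S, J.Nonempty → (∀ s x, x ∈ J → T.mul s x ∈ J ∧ T.mul x s ∈ J) →
    J = {T.zero} ∨ J = Set.univ

/-- The semilattice of idempotents of `S` is 0-disjunctive. -/
def ZeroDisjunctive (T : AssocISG Γ Gs) : Prop :=
  ∀ e f, T.IsIdem e → T.IsIdem f → e ≠ T.zero → f ≠ T.zero → e ≠ f →
    ∃ h, T.IsIdem h ∧ Xor' (T.mul e h = T.zero) (T.mul f h = T.zero)

end AssocISG

/-! ## The contracted inverse semigroup algebra `K S_{(G,Γ*)}` -/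

/-- The contracted inverse semigroup algebra of `S_{(G,Γ*)}` over a field `K` :
a (possibly nonunital) `K`-algebra with basis `S ∖ {0}` and multiplication extending
that of `S` (identifying the zeros of `S` and `K`). -/
structure ContractedAlg (K : Type) [Field K] {Γ : DirGraph} {Gs : SSG Γ}
    (T : AssocISG Γ Gs) where
  A : Type
  [ringA : NonUnitalRing A]
  [modA : Module K A]
  smul_mul : ∀ (k : K) (a b : A), (k • a) * b = k • (a * b)
  mul_smul_comm : ∀ (k : K) (a b : A), a * (k • b) = k • (a * b)
  δ : T.S → A
  δ_zero : δ T.zero = 0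
  δ_mul : ∀ s t, δ (T.mul s t) = δ s * δ t
  indep : LinearIndependent K (fun s : {s : T.S // s ≠ T.zero} => δ s.1)
  spans : ∀ a : A, a ∈ Submodule.span K (Set.range (fun s : {s : T.S // s ≠ T.zero} => δ s.1))

attribute [instance] ContractedAlg.ringA ContractedAlg.modA

/-- Product of a list in a (nonunital) ring, with the empty product read as `0`. -/
def listProd {A : Type} [Mul A] [Zero A] : List A → A
  | [] => 0
  | a :: l => l.foldl (· * ·) a

namespace ContractedAlg

variable {K : Type} [Field K] {Γ : DirGraph} {Gs : SSG Γ} {T : AssocISG Γ Gs}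

/-- A (two-sided, `K`-linear) ideal of the algebra, as a set. -/
def IsIdealSet (C : ContractedAlg K T) (J : Set C.A) : Prop :=
  (0 : C.A) ∈ J ∧ (∀ x y, x ∈ J → y ∈ J → x + y ∈ J) ∧ (∀ x, x ∈ J → -x ∈ J) ∧
  (∀ (k : K) x, x ∈ J → k • x ∈ J) ∧
  (∀ x y, x ∈ J → y * x ∈ J) ∧ (∀ x y, x ∈ J → x * y ∈ J)

/-- The ideal generated by a set. -/
def idealGen (C : ContractedAlg K T) (X : Set C.A) : Set C.A :=
  ⋂₀ {J | C.IsIdealSet J ∧ X ⊆ J}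

/-- The generators `∏_{f ∈ F} (e - f)` of the tight ideal, for `e` a nonzero idempotent
and `F` a finite cover of `e`. -/
def tightGens (C : ContractedAlg K T) : Set C.A :=
  {x | ∃ (e : T.S) (l : List T.S), T.IsIdem e ∧ e ≠ T.zero ∧ l ≠ [] ∧
    (∀ f ∈ l, T.IsIdem f ∧ T.idemLe f e) ∧
    (∀ g, T.IsIdem g → g ≠ T.zero → T.idemLe g e → ∃ f ∈ l, T.mul g f ≠ T.zero) ∧
    x = listProd (l.map fun f => C.δ e - C.δ f)}

/-- The tight ideal of `K S_{(G,Γ*)}`. -/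
def Itight (C : ContractedAlg K T) : Set C.A := C.idealGen C.tightGens

/-- The Cuntz–Krieger generators `v - ∑_{e ∈ vΓ¹} e e*`. -/
def ckGens (C : ContractedAlg K T) : Set C.A :=
  {x | ∃ v : Γ.V,
    x = C.δ (T.ιV v) -
      ∑ e ∈ (Γ.rowFinite v).toFinset, C.δ (T.mul (T.ιE e) (T.star (T.ιE e)))}

/-- The Cuntz–Krieger ideal of `K S_{(G,Γ*)}`. -/
def Ick (C : ContractedAlg K T) : Set C.A := C.idealGen C.ckGens

/-- An element `a` is singular: for every nonzero idempotent `e` there is a nonzero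
idempotent `f ≤ e` with `a f = 0`. -/
def IsSingular (C : ContractedAlg K T) (a : C.A) : Prop :=
  ∀ e, T.IsIdem e → e ≠ T.zero →
    ∃ f, T.IsIdem f ∧ f ≠ T.zero ∧ T.idemLe f e ∧ a * C.δ f = 0

/-- The essential (singular) ideal of `K S_{(G,Γ*)}`. -/
def Iess (C : ContractedAlg K T) : Set C.A := {a | C.IsSingular a}

/-- The quotient of the algebra by the ideal `I` is simple. -/
def QuotSimple (C : ContractedAlg K T) (I : Set C.A) : Prop :=
  I ≠ Set.univ ∧ ∀ J, C.IsIdealSet J → I ⊆ J → J = I ∨ J = Set.univ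

end ContractedAlg
/-! ## Collapsing self-similar groupoids -/

/-- A morphism of directed graphs. -/
structure GraphHom (Γ Λ : DirGraph) where
  vmap : Γ.V → Λ.V
  emap : Γ.E → Λ.E
  hsrc : ∀ e, Λ.src (emap e) = vmap (Γ.src e)
  hrng : ∀ e, Λ.rng (emap e) = vmap (Γ.rng e)

/-- The induced map on paths. -/
def GraphHom.pmap {Γ Λ : DirGraph} (β : GraphHom Γ Λ) (l : List Γ.E) : List Λ.E :=
  l.map β.emap

/-- `F` is a system of collapsing isomorphisms for `(G, Γ*)` : a wide subgroupoid of `G`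
containing all identities, with at most one arrow between any two objects, and with an
arrow `u → v` whenever `G` has one (as produced by choosing orbit representatives `R`
and isomorphisms `f_u` with `id_u = f_u⁻¹ id_v f_u`). -/
def IsFsystem {Γ : DirGraph} (Gs : SSG Γ) (F : Set (Arrow Γ)) : Prop :=
  F ⊆ Gs.carrier ∧
  (∀ g g', g ∈ F → g.Same g' → g' ∈ F) ∧
  (∀ v, Arrow.idArrow Γ v ∈ F) ∧
  (∀ g h k, g ∈ F → h ∈ F → Arrow.IsComposition g h k → k ∈ F) ∧
  (∀ g k, g ∈ F → Arrow.IsInverseArrow g k → k ∈ F) ∧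
  (∀ g g', g ∈ F → g' ∈ F → g.dom = g'.dom → g.cod = g'.cod → g.Same g') ∧
  (∀ g ∈ Gs.carrier, ∃ f ∈ F, f.dom = g.dom ∧ f.cod = g.cod)

/-- `β : Γ → Λ` is the quotient graph morphism determined by `F` : it is surjective and
locally bijective, its vertex fibres are exactly the `F`-orbits of vertices, and it is
invariant under the action of `F` on paths (so that the fibres on paths are exactly the
`∼_F`-classes). -/
def IsCollapse {Γ Λ : DirGraph} (Gs : SSG Γ) (F : Set (Arrow Γ)) (β : GraphHom Γ Λ) : Prop :=
  Function.Surjective β.vmap ∧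
  (∀ v : Γ.V, Set.BijOn β.emap {e | Γ.src e = v} {e' | Λ.src e' = β.vmap v}) ∧
  (∀ u v : Γ.V, β.vmap u = β.vmap v ↔ ∃ f ∈ F, f.dom = u ∧ f.cod = v) ∧
  (∀ f ∈ F, ∀ l, Γ.IsPathFrom f.dom l → β.pmap (f.act l) = β.pmap l)

/-- `m` is the tree isomorphism of `Λ*` induced by `g` under the identification `β`
(the image `α(g)` of `g` in the collapsed groupoid). -/
def IsPushArrow {Γ Λ : DirGraph} (β : GraphHom Γ Λ) (g : Arrow Γ) (m : Arrow Λ) : Prop :=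
  m.dom = β.vmap g.dom ∧ m.cod = β.vmap g.cod ∧
  ∀ l, Γ.IsPathFrom g.dom l → m.act (β.pmap l) = β.pmap (g.act l)

/-- The collapsed groupoid `L = α(G)`, acting on `Λ*`. -/
def Lcarrier {Γ Λ : DirGraph} (Gs : SSG Γ) (β : GraphHom Γ Λ) : Set (Arrow Λ) :=
  {m | ∃ g ∈ Gs.carrier, IsPushArrow β g m}

/-! ## The graph Δ : cycles of the Moore diagram, the sets `I_q`, synchronization -/

/-- Membership in `N` up to representing the same tree isomorphism. -/
def memSame {Γ : DirGraph} (N : Set (Arrow Γ)) (g : Arrow Γ) : Prop :=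
  ∃ h ∈ N, g.Same h

/-- The set `C` of elements of the nucleus `N` lying on a nonempty cycle of the subgraph
`H` of the Moore diagram of `N` consisting of the edges labelled `(e, e)` : `g ∈ C` iff
`g ∈ N` and there is a nonempty path `p` with `g(p) = p`, `g|_p = g`, and all the
intermediate restrictions `g|_{p'}` (for prefixes `p'` of `p`) in `N`. -/
def Cset {Γ : DirGraph} (N : Set (Arrow Γ)) : Set (Arrow Γ) :=
  {g | memSame N g ∧ ∃ p : List Γ.E, p ≠ [] ∧ Γ.IsPathFrom g.dom p ∧ g.act p = p ∧
    g.IsRestrictOf p g ∧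
    ∀ l₁ l₂ : List Γ.E, p = l₁ ++ l₂ → ∃ h, memSame N h ∧ g.IsRestrictOf l₁ h}

/-- The vertex `I_q = q · {id_{r(q)}} = {g ∈ C : g(q) = q, g|_q = id}` of `Δ`,
for a path `q ∈ vΓ*`. -/
def Iq {Γ : DirGraph} (N : Set (Arrow Γ)) (v : Γ.V) (q : List Γ.E) : Set (Arrow Γ) :=
  {g | g ∈ Cset N ∧ g.dom = v ∧ g.cod = v ∧
    ∀ w, Γ.IsPathFrom (Γ.rng0 v q) w → g.act (q ++ w) = q ++ w}

/-- The path `p ∈ vΓ*` is synchronizing in `Δ` : every path of `Δ` labelled by the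
reversal of `p` ends at the same vertex, i.e. `I_{pq} = I_{pq'}` for all `q, q' ∈ r(p)Γ*`. -/
def Synchronizing {Γ : DirGraph} (N : Set (Arrow Γ)) (v : Γ.V) (p : List Γ.E) : Prop :=
  Γ.IsPathFrom v p ∧
  ∀ q q', Γ.IsPathFrom (Γ.rng0 v p) q → Γ.IsPathFrom (Γ.rng0 v p) q' →
    Iq N v (p ++ q) = Iq N v (p ++ q')

/-- A vertex `X` of `Δ` is synchronized: `X = I_w` for some synchronizing path `w`. -/
def SyncVertex {Γ : DirGraph} (N : Set (Arrow Γ)) (X : Set (Arrow Γ)) : Prop :=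
  ∃ v p, Synchronizing N v p ∧ X = Iq N v p

/-- The vertex set `Q = {I_q : q ∈ Γ*}` of the Schreier graph `Δ`. -/
def Qset {Γ : DirGraph} (N : Set (Arrow Γ)) : Set (Set (Arrow Γ)) :=
  {X | ∃ v q, Γ.IsPathFrom v q ∧ X = Iq N v q}

/-- The edge relation of `Δ` : an edge labelled `e` from `I_q` to `I_{eq}`. -/
def DeltaStep {Γ : DirGraph} (N : Set (Arrow Γ)) (X Y : Set (Arrow Γ)) : Prop :=
  ∃ v q e, Γ.IsPathFrom v q ∧ Γ.rng e = v ∧ X = Iq N v q ∧ Y = Iq N (Γ.src e) (e :: q)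

/-- Reachability in `Δ`. -/
def DeltaReaches {Γ : DirGraph} (N : Set (Arrow Γ)) : Set (Arrow Γ) → Set (Arrow Γ) → Prop :=
  Relation.ReflTransGen (DeltaStep N)

/-- A vertex of `Δ` lying in a minimal strongly connected component with respect to
reachability. -/
def DeltaMinVert {Γ : DirGraph} (N : Set (Arrow Γ)) (X : Set (Arrow Γ)) : Prop :=
  X ∈ Qset N ∧ ∀ Y ∈ Qset N, DeltaReaches N X Y → DeltaReaches N Y X

/- `π_{p,q}(a) = 0` for `a = ∑_{g ∈ Tset} c_g · g ∈ K H_p`, where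
`π_{p,q} : K H_p → K[H_p / (H_p ∩ I_q)]` is induced by the canonical map of `H_p` onto
the left cosets of `H_p ∩ I_q` : the sum of the coefficients over each left coset of
`H_p ∩ I_q` vanishes. -/
open Classical in
def PiZero (K : Type) [Field K] {Γ : DirGraph} (Gs : SSG Γ) (N : Set (Arrow Γ))
    (v : Γ.V) (p q : List Γ.E) (Tset : Finset (Arrow Γ)) (c : Arrow Γ → K) : Prop :=
  ∀ g₀ ∈ Hp Gs v p,
    (∑ h ∈ Tset,
      if ∃ k, k ∈ Hp Gs v p ∧ k ∈ Iq N v q ∧ Arrow.IsComposition g₀ k h then c h else 0) = 0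

namespace AssocISG

variable {Γ : DirGraph} {Gs : SSG Γ}

/-- A path with source `v` is fixed by left multiplication by `v`. -/
lemma ιV_mul_pathProd (T : AssocISG Γ Gs) (v : Γ.V) (p : List Γ.E) (hp : Γ.IsPathFrom v p) :
    T.mul (T.ιV v) (pathProd T.mul T.ιV T.ιE v p) = pathProd T.mul T.ιV T.ιE v p := by
  cases p with
  | nil => exact T.rel_v_idem v
  | cons e l =>
    obtain ⟨rfl, -⟩ := hp
    change T.mul _ (T.mul (T.ιE e) _) = T.mul (T.ιE e) _
    rw [← T.mul_assoc, T.rel_src]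

/-- If `u` fixes `a` on the left, then `u` fixes `a*` on the right. -/
lemma star_mul_of_mul_eq (T : AssocISG Γ Gs) {u a : T.S} (h : T.mul u a = a) :
    T.mul (T.star a) u = T.star a := by
  apply T.inv_unique
  · rw [T.mul_assoc, T.mul_assoc, h, ← T.mul_assoc, (T.inv_ax a).1]
  · rw [T.mul_assoc (T.star a) u a, h, ← T.mul_assoc, (T.inv_ax a).2]

lemma exists_ιV_mul_eq (T : AssocISG Γ Gs) {s : T.S} (hs : s ≠ T.zero) :
    ∃ v, T.mul (T.ιV v) s = s := by
  obtain ⟨v, w, p, q, g, hp, -, -, -, -, rfl⟩ := T.canon_ex s hs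
  exact ⟨v, by rw [← T.mul_assoc, ← T.mul_assoc, T.ιV_mul_pathProd v p hp]⟩

lemma exists_mul_ιV_eq (T : AssocISG Γ Gs) {s : T.S} (hs : s ≠ T.zero) :
    ∃ w, T.mul s (T.ιV w) = s := by
  obtain ⟨v, w, p, q, g, -, hq, -, -, -, rfl⟩ := T.canon_ex s hs
  exact ⟨w, by rw [T.mul_assoc, T.star_mul_of_mul_eq (T.ιV_mul_pathProd w q hq)]⟩

end AssocISG

namespace ContractedAlg

variable {K : Type} [Field K] {Γ : DirGraph} {Gs : SSG Γ} {T : AssocISG Γ Gs}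

lemma δ_ιV_mul_of_ne (C : ContractedAlg K T) {u v : Γ.V} (h : u ≠ v) :
    C.δ (T.ιV u) * C.δ (T.ιV v) = 0 := by
  rw [← C.δ_mul, T.rel_vv u v h, C.δ_zero]

lemma sum_δ_ιV_mul [Fintype Γ.V] (C : ContractedAlg K T) (a : C.A) :
    (∑ v : Γ.V, C.δ (T.ιV v)) * a = a := by
  induction C.spans a using Submodule.span_induction with
  | mem x hx =>
    obtain ⟨⟨s, hs⟩, rfl⟩ := hx
    obtain ⟨v, hv⟩ := T.exists_ιV_mul_eq hs
    have hδ : C.δ (T.ιV v) * C.δ s = C.δ s := by rw [← C.δ_mul, hv]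
    change _ * C.δ s = C.δ s
    rw [Finset.sum_mul, Finset.sum_eq_single v, hδ]
    · intro u _ hu
      rw [← hδ, ← mul_assoc, C.δ_ιV_mul_of_ne hu, zero_mul]
    · simp
  | zero => exact mul_zero _
  | add x y _ _ hx hy => rw [mul_add, hx, hy]
  | smul k x _ hx => rw [C.mul_smul_comm, hx]

lemma mul_sum_δ_ιV [Fintype Γ.V] (C : ContractedAlg K T) (a : C.A) :
    a * (∑ v : Γ.V, C.δ (T.ιV v)) = a := by
  induction C.spans a using Submodule.span_induction with
  | mem x hx =>
    obtain ⟨⟨s, hs⟩, rfl⟩ := hx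
    obtain ⟨v, hv⟩ := T.exists_mul_ιV_eq hs
    have hδ : C.δ s * C.δ (T.ιV v) = C.δ s := by rw [← C.δ_mul, hv]
    change C.δ s * _ = C.δ s
    rw [Finset.mul_sum, Finset.sum_eq_single v, hδ]
    · intro u _ hu
      rw [← hδ, mul_assoc, C.δ_ιV_mul_of_ne hu.symm, mul_zero]
    · simp
  | zero => exact zero_mul _
  | add x y _ _ hx hy => rw [add_mul, hx, hy]
  | smul k x _ hx => rw [C.smul_mul, hx]

lemma IsIdealSet.sum_mem {C : ContractedAlg K T} {J : Set C.A} (hJ : C.IsIdealSet J)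
    {ι : Type*} (s : Finset ι) (f : ι → C.A) (hf : ∀ i ∈ s, f i ∈ J) : ∑ i ∈ s, f i ∈ J :=
  Finset.sum_induction f (· ∈ J) hJ.2.1 hJ.1 hf

lemma isIdealSet_idealGen (C : ContractedAlg K T) (X : Set C.A) :
    C.IsIdealSet (C.idealGen X) := by
  refine ⟨?_, ?_, ?_, ?_, ?_, ?_⟩
  · exact fun J hJ => hJ.1.1
  · exact fun x y hx hy J hJ => hJ.1.2.1 x y (hx J hJ) (hy J hJ)
  · exact fun x hx J hJ => hJ.1.2.2.1 x (hx J hJ)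
  · exact fun k x hx J hJ => hJ.1.2.2.2.1 k x (hx J hJ)
  · exact fun x y hx J hJ => hJ.1.2.2.2.2.1 x y (hx J hJ)
  · exact fun x y hx J hJ => hJ.1.2.2.2.2.2 x y (hx J hJ)

lemma subset_idealGen (C : ContractedAlg K T) (X : Set C.A) : X ⊆ C.idealGen X :=
  fun _ hx _ hJ => hJ.2 hx

lemma idealGen_subset {C : ContractedAlg K T} {X J : Set C.A} (hJ : C.IsIdealSet J)
    (h : X ⊆ J) : C.idealGen X ⊆ J :=
  fun _ hx => hx J ⟨hJ, h⟩

lemma δ_ιV_src_mul (C : ContractedAlg K T) (e : Γ.E) :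
    C.δ (T.ιV (Γ.src e)) * C.δ (T.mul (T.ιE e) (T.star (T.ιE e))) =
      C.δ (T.mul (T.ιE e) (T.star (T.ιE e))) := by
  rw [← C.δ_mul, ← T.mul_assoc, T.rel_src]

/-- Multiplying `1 - ∑ e e*` by a vertex `v` gives the Cuntz–Krieger generator at `v`. -/
lemma δ_ιV_mul_one_sub [Fintype Γ.V] [Fintype Γ.E] (C : ContractedAlg K T) (v : Γ.V) :
    C.δ (T.ιV v) * ((∑ u : Γ.V, C.δ (T.ιV u)) -
        ∑ e : Γ.E, C.δ (T.mul (T.ιE e) (T.star (T.ιE e)))) =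
      C.δ (T.ιV v) -
        ∑ e ∈ (Γ.rowFinite v).toFinset, C.δ (T.mul (T.ιE e) (T.star (T.ιE e))) := by
  rw [mul_sub, C.mul_sum_δ_ιV, Finset.mul_sum]
  congr 1
  rw [← Finset.sum_subset (Finset.subset_univ (Γ.rowFinite v).toFinset)]
  · refine Finset.sum_congr rfl fun e he => ?_
    obtain rfl : Γ.src e = v := by simpa using he
    exact C.δ_ιV_src_mul e
  · intro e _ he
    have hne : v ≠ Γ.src e := fun h => he (by simp [h])
    rw [← C.δ_ιV_src_mul, ← mul_assoc, C.δ_ιV_mul_of_ne hne, zero_mul]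

end ContractedAlg

/-! ## STATEMENT 5 -/

/-- Theorem: if `Γ` is finite then `K S_{(G,Γ*)}` is unital with identity
`1 = ∑_{v ∈ Γ⁰} v`, and the Cuntz–Krieger ideal is principally generated by
`1 - ∑_{e ∈ Γ¹} e e*`. -/
theorem statement5 (K : Type) [Field K] (Γ : DirGraph) [Fintype Γ.V] [Fintype Γ.E]
    (Gs : SSG Γ) (T : AssocISG Γ Gs) (C : ContractedAlg K T) :
    (∀ a : C.A, (∑ v : Γ.V, C.δ (T.ιV v)) * a = a ∧ a * (∑ v : Γ.V, C.δ (T.ιV v)) = a) ∧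
    C.Ick = C.idealGen
      {(∑ v : Γ.V, C.δ (T.ιV v)) - ∑ e : Γ.E, C.δ (T.mul (T.ιE e) (T.star (T.ιE e)))} := by
  refine ⟨fun a => ⟨C.sum_δ_ιV_mul a, C.mul_sum_δ_ιV a⟩, Set.Subset.antisymm ?_ ?_⟩
  · refine ContractedAlg.idealGen_subset (C.isIdealSet_idealGen _) ?_
    rintro _ ⟨v, rfl⟩
    rw [← C.δ_ιV_mul_one_sub]
    exact (C.isIdealSet_idealGen _).2.2.2.2.1 _ _ (C.subset_idealGen _ rfl)
  · refine ContractedAlg.idealGen_subset (C.isIdealSet_idealGen _) ?_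
    rintro _ rfl
    rw [← C.sum_δ_ιV_mul (_ - _), Finset.sum_mul]
    refine (C.isIdealSet_idealGen _).sum_mem _ _ fun v _ => C.subset_idealGen _ ⟨v, ?_⟩
    exact C.δ_ιV_mul_one_sub v
end

section
/- Let (G, Γ*) be a self-similar groupoid, K a field, and a ∈ KS_{(G,Γ*)}. Then a is singular if and only if for all p ∈ Γ* there exists some q ∈ r(p)Γ* such that apq = 0. -/
set_option autoImplicit false

/-! ## STATEMENT 7 -/

/-! ### Paths and inverse arrows -/

namespace DirGraph

variable {Γ : DirGraph}

theorem isPathFrom_append {v : Γ.V} {p q : List Γ.E} :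
    Γ.IsPathFrom v (p ++ q) ↔ Γ.IsPathFrom v p ∧ Γ.IsPathFrom (Γ.rng0 v p) q := by
  induction p generalizing v with
  | nil => simp [IsPathFrom, rng0]
  | cons e p ih => simp [IsPathFrom, rng0, ih, and_assoc]

theorem rng0_append (v : Γ.V) (p q : List Γ.E) :
    Γ.rng0 v (p ++ q) = Γ.rng0 (Γ.rng0 v p) q := by
  induction p generalizing v with
  | nil => rfl
  | cons e p ih => exact ih _

end DirGraph

namespace Arrow

variable {Γ : DirGraph}

/-- The inverse tree isomorphism. -/
def inverse (g : Arrow Γ) : Arrow Γ where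
  dom := g.cod
  cod := g.dom
  act := g.inv
  inv := g.act
  act_maps := g.inv_maps
  inv_maps := g.act_maps
  left_inv := g.right_inv
  right_inv := g.left_inv
  act_nil := by simpa [g.act_nil] using g.left_inv [] trivial
  act_snoc := by
    intro l e hl
    have hm := g.inv_maps _ hl
    have hr := g.right_inv _ hl
    rcases List.eq_nil_or_concat (g.inv (l ++ [e])) with h | ⟨m, e', h⟩
    · rw [h, g.act_nil] at hr
      simp at hr
    · rw [List.concat_eq_append] at h
      rw [h] at hm hr
      obtain ⟨e'', he⟩ := g.act_snoc m e' hm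
      rw [he] at hr
      have hml : g.act m = l := (List.append_inj' hr rfl).1
      refine ⟨e', ?_⟩
      rw [h, ← hml, g.left_inv m (DirGraph.isPathFrom_append.1 hm).1]

theorem isInverseArrow_inverse (g : Arrow Γ) : g.IsInverseArrow g.inverse :=
  ⟨rfl, rfl, g.left_inv⟩

theorem isComposition_inverse (g : Arrow Γ) :
    IsComposition g g.inverse (idArrow Γ g.cod) :=
  ⟨rfl, rfl, rfl, fun l hl => (g.right_inv l hl).symm⟩

end Arrow

/-! ### Computations in the associated inverse semigroup -/

namespace AssocISG

variable {Γ : DirGraph} {Gs : SSG Γ} (T : AssocISG Γ Gs)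

theorem IsIdem.star_eq {T : AssocISG Γ Gs} {e : T.S} (he : T.IsIdem e) : T.star e = e := by
  have h : T.mul (T.mul e e) e = e := by rw [he, he]
  exact (T.inv_unique e e h h).symm

theorem isIdem_mul_star (x : T.S) : T.IsIdem (T.mul x (T.star x)) := by
  unfold IsIdem
  rw [← T.mul_assoc, (T.inv_ax x).1]

theorem mul_mul_star_cancel (x y : T.S) :
    T.mul x (T.mul (T.star x) (T.mul x y)) = T.mul x y := by
  rw [← T.mul_assoc, ← T.mul_assoc, (T.inv_ax x).1]

theorem star_mul_mul_cancel (x y : T.S) :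
    T.mul (T.star x) (T.mul x (T.mul (T.star x) y)) = T.mul (T.star x) y := by
  rw [← T.mul_assoc, ← T.mul_assoc, (T.inv_ax x).2]

theorem star_mul_of_absorb {x y : T.S} (h : T.mul (T.mul (T.star x) x) y = y) :
    T.star (T.mul x y) = T.mul (T.star y) (T.star x) := by
  rw [T.mul_assoc] at h
  symm
  apply T.inv_unique
  · simp only [T.mul_assoc]
    rw [h, ← T.mul_assoc y, (T.inv_ax y).1]
  · simp only [T.mul_assoc]
    rw [← T.mul_assoc x y, ← T.mul_assoc (T.star x), h, T.star_mul_mul_cancel]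

theorem ιG_mul_ιV {g : Arrow Γ} (hg : g ∈ Gs.carrier) :
    T.mul (T.ιG g) (T.ιV g.dom) = T.ιG g := by
  rw [← T.rel_id]
  exact T.rel_comp _ _ _ hg (Gs.id_mem _) ⟨rfl, rfl, rfl, fun _ _ => rfl⟩

theorem ιG_mul_star {g : Arrow Γ} (hg : g ∈ Gs.carrier) :
    T.mul (T.ιG g) (T.star (T.ιG g)) = T.ιV g.cod := by
  rw [T.rel_star g _ hg g.isInverseArrow_inverse, ← T.rel_id]
  exact T.rel_comp _ _ _ hg (Gs.inv_mem g _ hg g.isInverseArrow_inverse) g.isComposition_inverse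

theorem P_nil (v : Γ.V) : T.P v [] = T.ιV v := rfl

theorem P_cons (v : Γ.V) (e : Γ.E) (p : List Γ.E) :
    T.P v (e :: p) = T.mul (T.ιE e) (T.P (Γ.rng e) p) := rfl

theorem ιV_mul_P {v : Γ.V} {p : List Γ.E} (hp : Γ.IsPathFrom v p) :
    T.mul (T.ιV v) (T.P v p) = T.P v p := by
  cases p with
  | nil => exact T.rel_v_idem v
  | cons e p =>
    obtain ⟨rfl, -⟩ := hp
    rw [P_cons, ← T.mul_assoc, T.rel_src]

theorem P_mul_ιV (v : Γ.V) (p : List Γ.E) :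
    T.mul (T.P v p) (T.ιV (Γ.rng0 v p)) = T.P v p := by
  induction p generalizing v with
  | nil => exact T.rel_v_idem v
  | cons e p ih =>
    rw [P_cons, T.mul_assoc]
    exact congrArg _ (ih _)

theorem P_append {v : Γ.V} {p q : List Γ.E} (hq : Γ.IsPathFrom (Γ.rng0 v p) q) :
    T.P v (p ++ q) = T.mul (T.P v p) (T.P (Γ.rng0 v p) q) := by
  induction p generalizing v with
  | nil => exact (T.ιV_mul_P hq).symm
  | cons e p ih =>
    rw [List.cons_append, P_cons, P_cons, ih hq, T.mul_assoc]
    rfl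

theorem star_P_cons {v : Γ.V} {e : Γ.E} {p : List Γ.E} (hp : Γ.IsPathFrom (Γ.rng e) p) :
    T.star (T.P v (e :: p)) = T.mul (T.star (T.P (Γ.rng e) p)) (T.star (T.ιE e)) :=
  T.star_mul_of_absorb (x := T.ιE e) (y := T.P (Γ.rng e) p) (by rw [T.rel_ee, T.ιV_mul_P hp])

theorem star_P_mul_P {v : Γ.V} {p : List Γ.E} (hp : Γ.IsPathFrom v p) :
    T.mul (T.star (T.P v p)) (T.P v p) = T.ιV (Γ.rng0 v p) := by
  induction p generalizing v with
  | nil => rw [P_nil, T.rel_star_v, T.rel_v_idem]; rfl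
  | cons e p ih =>
    rw [T.star_P_cons hp.2, P_cons, T.mul_assoc, ← T.mul_assoc (T.star (T.ιE e)), T.rel_ee,
      T.ιV_mul_P hp.2]
    exact ih hp.2

theorem star_P_mul_ιV {v : Γ.V} {p : List Γ.E} (hp : Γ.IsPathFrom v p) :
    T.mul (T.star (T.P v p)) (T.ιV v) = T.star (T.P v p) := by
  have h := T.star_mul_of_absorb (x := T.ιV v) (y := T.P v p)
    (by rw [T.rel_star_v, T.rel_v_idem, T.ιV_mul_P hp])
  rw [T.ιV_mul_P hp, T.rel_star_v] at h
  exact h.symm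

theorem star_P_append {v : Γ.V} {p q : List Γ.E} (hp : Γ.IsPathFrom v p)
    (hq : Γ.IsPathFrom (Γ.rng0 v p) q) :
    T.star (T.P v (p ++ q)) = T.mul (T.star (T.P (Γ.rng0 v p) q)) (T.star (T.P v p)) := by
  rw [T.P_append hq]
  exact T.star_mul_of_absorb (by rw [T.star_P_mul_P hp, T.ιV_mul_P hq])

theorem P_mul_star_ne_zero {v : Γ.V} {p : List Γ.E} (hp : Γ.IsPathFrom v p) :
    T.mul (T.P v p) (T.star (T.P v p)) ≠ T.zero := by
  have h := T.canon_nonzero v v p p (Arrow.idArrow Γ (Γ.rng0 v p)) hp hp (Gs.id_mem _) rfl rfl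
  rw [T.rel_id] at h
  change T.mul (T.mul (T.P v p) _) (T.star (T.P v p)) ≠ _ at h
  rwa [P_mul_ιV] at h

/-- Paths `p`, `q` with `q* p ≠ 0` are comparable in the prefix order. -/
theorem comparable_of_star_P_mul_P_ne_zero {v w : Γ.V} {p q : List Γ.E}
    (hp : Γ.IsPathFrom v p) (hq : Γ.IsPathFrom w q)
    (h : T.mul (T.star (T.P w q)) (T.P v p) ≠ T.zero) :
    v = w ∧ (p <+: q ∨ q <+: p) := by
  have hvw : v = w := by
    by_contra hne
    apply h
    rw [← T.star_P_mul_ιV hq, ← T.ιV_mul_P hp, T.mul_assoc, ← T.mul_assoc (T.ιV w),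
      T.rel_vv w v (Ne.symm hne), T.zero_mul, T.mul_zero]
  refine ⟨hvw, ?_⟩
  induction q generalizing v w p with
  | nil => exact Or.inr List.nil_prefix
  | cons e q ih =>
    cases p with
    | nil => exact Or.inl List.nil_prefix
    | cons f p =>
      rw [T.star_P_cons hq.2, P_cons, T.mul_assoc, ← T.mul_assoc (T.star (T.ιE e))] at h
      obtain rfl : e = f := by
        by_contra hne
        apply h
        rw [T.rel_ef e f hne, T.zero_mul, T.mul_zero]
      rw [T.rel_ee, T.ιV_mul_P hp.2] at h
      simpa [List.cons_prefix_cons] using ih hp.2 hq.2 h rfl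

/-- Every nonzero idempotent of `S` has the form `p p*` for a path `p`. -/
theorem IsIdem.exists_eq_P_mul_star {T : AssocISG Γ Gs} {e : T.S} (he : T.IsIdem e)
    (h0 : e ≠ T.zero) :
    ∃ v p, Γ.IsPathFrom v p ∧ e = T.mul (T.P v p) (T.star (T.P v p)) := by
  obtain ⟨v, w, p, q, g, hp, hq, hg, hd, hc, hs⟩ := T.canon_ex e h0
  refine ⟨v, p, hp, ?_⟩
  change e = T.mul (T.mul (T.P v p) (T.ιG g)) (T.star (T.P w q)) at hs
  have hqq := T.star_P_mul_P hq
  have hpp := T.star_P_mul_P hp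
  rw [← hd] at hqq
  rw [← hc] at hpp
  have hgg : T.mul (T.ιG g) (T.mul (T.ιV g.dom) (T.star (T.ιG g))) = T.ιV g.cod := by
    rw [← T.mul_assoc, T.ιG_mul_ιV hg, T.ιG_mul_star hg]
  have hpV : T.mul (T.P v p) (T.ιV g.cod) = T.P v p := by rw [hc]; exact T.P_mul_ιV v p
  have hqV : T.mul (T.P w q) (T.ιV g.dom) = T.P w q := by rw [hd]; exact T.P_mul_ιV w q
  have hstar : T.mul (T.mul (T.P w q) (T.star (T.ιG g))) (T.star (T.P v p)) = T.star e := by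
    have hpq : T.mul e (T.mul (T.mul (T.P w q) (T.star (T.ιG g))) (T.star (T.P v p))) =
        T.mul (T.P v p) (T.star (T.P v p)) := by
      rw [hs]
      simp only [T.mul_assoc]
      rw [← T.mul_assoc (T.star (T.P w q)), hqq, ← T.mul_assoc (T.ιV g.dom),
        ← T.mul_assoc (T.ιG g), hgg, ← T.mul_assoc (T.P v p), hpV]
    apply T.inv_unique
    · rw [hpq, hs]
      simp only [T.mul_assoc]
      exact T.mul_mul_star_cancel _ _
    · rw [T.mul_assoc, hpq]
      simp only [T.mul_assoc]
      rw [← T.mul_assoc (T.star (T.P v p)), (T.inv_ax (T.P v p)).2]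
  have hes : e = T.mul e (T.star e) := by rw [he.star_eq, he]
  rw [hes, ← hstar, hs]
  simp only [T.mul_assoc]
  rw [← T.mul_assoc (T.star (T.P w q)), hqq, ← T.mul_assoc (T.ιV g.dom),
    ← T.mul_assoc (T.ιG g), hgg, ← T.mul_assoc (T.P v p), hpV]

end AssocISG

/-- Theorem: `a ∈ K S_{(G,Γ*)}` is singular iff for every path `p ∈ Γ*` there is a path
`q ∈ r(p)Γ*` with `a p q = 0`. -/
theorem statement7 (K : Type) [Field K] (Γ : DirGraph) (Gs : SSG Γ) (T : AssocISG Γ Gs)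
    (C : ContractedAlg K T) (a : C.A) :
    C.IsSingular a ↔
      ∀ (v : Γ.V) (p : List Γ.E), Γ.IsPathFrom v p →
        ∃ q, Γ.IsPathFrom (Γ.rng0 v p) q ∧ a * C.δ (T.P v (p ++ q)) = 0 := by
  constructor
  · intro ha v p hp
    obtain ⟨f, hf, hf0, ⟨g, -, hfg⟩, haf⟩ :=
      ha _ (T.isIdem_mul_star (T.P v p)) (T.P_mul_star_ne_zero hp)
    obtain ⟨w, q, hq, hfq⟩ := hf.exists_eq_P_mul_star hf0
    have hfe : T.mul f (T.mul (T.P v p) (T.star (T.P v p))) = f := by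
      rw [hfg, T.mul_assoc, T.isIdem_mul_star]
    have hne : T.mul (T.star (T.P w q)) (T.P v p) ≠ T.zero := by
      intro h
      apply hf0
      rw [← hfe, hfq, T.mul_assoc, ← T.mul_assoc (T.star (T.P w q)), h, T.zero_mul, T.mul_zero]
    have haq : a * C.δ (T.P w q) = 0 := by
      rw [← (T.inv_ax (T.P w q)).1, ← hfq, C.δ_mul, ← _root_.mul_assoc, haf,
        MulZeroClass.zero_mul]
    obtain ⟨rfl, ⟨r, rfl⟩ | ⟨r, rfl⟩⟩ := T.comparable_of_star_P_mul_P_ne_zero hp hq hne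
    · exact ⟨r, (DirGraph.isPathFrom_append.1 hq).2, haq⟩
    · refine ⟨[], trivial, ?_⟩
      rw [List.append_nil, T.P_append (DirGraph.isPathFrom_append.1 hp).2, C.δ_mul,
        ← _root_.mul_assoc, haq, MulZeroClass.zero_mul]
  · intro ha e he he0
    obtain ⟨v, p, hp, rfl⟩ := he.exists_eq_P_mul_star he0
    obtain ⟨q, hq, haq⟩ := ha v p hp
    have hpq := DirGraph.isPathFrom_append.2 ⟨hp, hq⟩
    refine ⟨_, T.isIdem_mul_star (T.P v (p ++ q)), T.P_mul_star_ne_zero hpq,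
      ⟨_, T.isIdem_mul_star (T.P v (p ++ q)), ?_⟩, ?_⟩
    · rw [T.star_P_append hp hq]
      simp only [T.mul_assoc]
      rw [← T.mul_assoc (T.star (T.P v p)), (T.inv_ax (T.P v p)).2]
    · rw [C.δ_mul, ← _root_.mul_assoc, haq, MulZeroClass.zero_mul]
end
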